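/- If q^8 ≠ 1, the ordered monomials form a K-basis of U_q^+(A_N): the family (m_α), indexed by the finitely supported functions α : Λ_N → ℕ, is K-linearly independent and spans U_q^+(A_N). Equivalently, the images in U_q^+(A_N) of the words X_{i₁j₁}X_{i₂j₂}⋯X_{i_kj_k} with (i₁,j₁) ≤_lex (i₂,j₂) ≤_lex ⋯ ≤_lex (i_k,j_k) (together with 1) form a K-basis; this is the content of the statement that the Jimbo relations form a Gröbner basis of the defining ideal with set of leading monomials { X_{mn}X_{ij} : (i,j) <_lex (m,n) }. -/

import Mathlib

/-- The index set Λ_N = {(i,j) : 1 ≤ i < j ≤ N+1}. -/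
def Lam (N : ℕ) : Type := {p : ℕ × ℕ // 1 ≤ p.1 ∧ p.1 < p.2 ∧ p.2 ≤ N + 1}

/-- Lexicographic linear order on Λ_N: (l,k) < (i,j) iff l < i, or l = i and k < j. -/
instance (N : ℕ) : LinearOrder (Lam N) :=
  LinearOrder.lift' (fun p => toLex p.val) (fun a b h => Subtype.ext (toLex.injective h))

/-- The Jimbo relations defining U_q^+(A_N): here `a = (i,j)` and `b = (m,n)`. -/
inductive JimboRel (K : Type) [Field K] (q : K) (N : ℕ) :
    FreeAlgebra K (Lam N) → FreeAlgebra K (Lam N) → Prop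
  /-- C1 : i = m < j < n -/
  | c1 : ∀ a b : Lam N, a.1.1 = b.1.1 → a.1.2 < b.1.2 →
      JimboRel K q N (FreeAlgebra.ι K b * FreeAlgebra.ι K a)
        ((q ^ 2)⁻¹ • (FreeAlgebra.ι K a * FreeAlgebra.ι K b))
  /-- C3 : i < m < j = n -/
  | c3 : ∀ a b : Lam N, a.1.1 < b.1.1 → a.1.2 = b.1.2 →
      JimboRel K q N (FreeAlgebra.ι K b * FreeAlgebra.ι K a)
        ((q ^ 2)⁻¹ • (FreeAlgebra.ι K a * FreeAlgebra.ι K b))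
  /-- C2 : i < m < n < j -/
  | c2 : ∀ a b : Lam N, a.1.1 < b.1.1 → b.1.2 < a.1.2 →
      JimboRel K q N (FreeAlgebra.ι K b * FreeAlgebra.ι K a)
        (FreeAlgebra.ι K a * FreeAlgebra.ι K b)
  /-- C6 : i < j < m < n -/
  | c6 : ∀ a b : Lam N, a.1.2 < b.1.1 →
      JimboRel K q N (FreeAlgebra.ι K b * FreeAlgebra.ι K a)
        (FreeAlgebra.ι K a * FreeAlgebra.ι K b)
  /-- C4 : i < m < j < n, with c = (i,n) and d = (m,j) -/
  | c4 : ∀ a b c d : Lam N, a.1.1 < b.1.1 → b.1.1 < a.1.2 → a.1.2 < b.1.2 →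
      c.1 = (a.1.1, b.1.2) → d.1 = (b.1.1, a.1.2) →
      JimboRel K q N (FreeAlgebra.ι K b * FreeAlgebra.ι K a)
        (FreeAlgebra.ι K a * FreeAlgebra.ι K b
          - (q ^ 2 - (q ^ 2)⁻¹) • (FreeAlgebra.ι K c * FreeAlgebra.ι K d))
  /-- C5 : i < j = m < n, with c = (i,n) -/
  | c5 : ∀ a b c : Lam N, a.1.2 = b.1.1 → c.1 = (a.1.1, b.1.2) →
      JimboRel K q N (FreeAlgebra.ι K b * FreeAlgebra.ι K a)
        ((q ^ 2) • (FreeAlgebra.ι K a * FreeAlgebra.ι K b) - q • FreeAlgebra.ι K c)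

/-- U_q^+(A_N): the free algebra on the X_{ij} modulo the Jimbo relations. -/
abbrev UqPlus (K : Type) [Field K] (q : K) (N : ℕ) := RingQuot (JimboRel K q N)

/-- x_{ij}: the image of the generator X_{ij} in U_q^+(A_N). -/
noncomputable def xg (K : Type) [Field K] (q : K) (N : ℕ) (p : Lam N) : UqPlus K q N :=
  RingQuot.mkAlgHom K (JimboRel K q N) (FreeAlgebra.ι K p)

/-- The ordered monomial m_α = ∏ x_{ij}^{α(i,j)}, the product taken in <_lex-increasing order. -/
noncomputable def mon (K : Type) [Field K] (q : K) (N : ℕ) (α : Lam N →₀ ℕ) : UqPlus K q N :=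
  ((α.support.sort (· ≤ ·)).map (fun p => xg K q N p ^ α p)).prod

/-- A monomial order on the finitely supported functions σ → ℕ: a well-founded strict
total order for which 0 is minimal and which is translation invariant. -/
def IsMonomialOrder (σ : Type) (r : (σ →₀ ℕ) → (σ →₀ ℕ) → Prop) : Prop :=
  WellFounded r ∧ (∀ α, ¬ r α α) ∧ (∀ α β γ, r α β → r β γ → r α γ) ∧
  (∀ α β, α ≠ β → r α β ∨ r β α) ∧ (∀ α, α ≠ 0 → r 0 α) ∧
  (∀ α β γ, r α β → r (α + γ) (β + γ))

section QuantumMatrix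

/-- The relations of the coordinate ring of quantum matrices with parameter `p` (in the uniform
`RTT` form), for a family `T` of elements of a `K`-algebra. -/
def IsQuantumMatrix {K A ι : Type*} [Field K] [Ring A] [Algebra K A] [LinearOrder ι]
    (p : K) (T : ι → ι → A) : Prop :=
  ∀ i k j l, (if i = k then p else 1) • (T i j * T k l)
      + (if k < i then p - p⁻¹ else 0) • (T k j * T i l)
    = (if j = l then p else 1) • (T k l * T i j)
      + (if j < l then p - p⁻¹ else 0) • (T k j * T i l)

namespace IsQuantumMatrix

variable {K A : Type*} [Field K] [Ring A] [Algebra K A]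

/-- The product of two quantum matrices with mutually commuting entries is a quantum matrix. -/
theorem mul {ι : Type*} [LinearOrder ι] {p : K} {T T' : ι → ι → A}
    (hT : IsQuantumMatrix p T) (hT' : IsQuantumMatrix p T')
    (hc : ∀ i j k l, Commute (T i j) (T' k l)) (S : Finset ι) :
    IsQuantumMatrix p (fun i j => ∑ a ∈ S, T i a * T' a j) := by
  intro i k j l
  have key : ∀ i k j l, (∑ a ∈ S, T i a * T' a j) * (∑ b ∈ S, T k b * T' b l)
      = ∑ a ∈ S, ∑ b ∈ S, (T i a * T k b) * (T' a j * T' b l) := by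
    intro i k j l
    rw [Finset.sum_mul_sum]
    refine Finset.sum_congr rfl fun a _ => Finset.sum_congr rfl fun b _ => ?_
    simp only [mul_assoc]
    congr 1
    simp only [← mul_assoc]
    rw [(hc k b a j).eq]
  have key' : ∀ i k j l, (∑ a ∈ S, T k a * T' a l) * (∑ b ∈ S, T i b * T' b j)
      = ∑ a ∈ S, ∑ b ∈ S, (T k b * T i a) * (T' b l * T' a j) := by
    intro i k j l
    rw [key, Finset.sum_comm]
  calc _ = ∑ a ∈ S, ∑ b ∈ S, ((if i = k then p else 1) • (T i a * T k b)
            + (if k < i then p - p⁻¹ else 0) • (T k a * T i b)) * (T' a j * T' b l) := by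
          simp only [key, Finset.smul_sum, ← Finset.sum_add_distrib, add_mul, smul_mul_assoc]
    _ = ∑ a ∈ S, ∑ b ∈ S, (T k b * T i a) * ((if a = b then p else 1) • (T' a j * T' b l)) +
        ∑ a ∈ S, ∑ b ∈ S, (T k a * T i b) *
          ((if a < b then p - p⁻¹ else 0) • (T' a j * T' b l)) := by
          simp only [hT i k, ← Finset.sum_add_distrib, add_mul, smul_mul_assoc, mul_smul_comm]
    _ = ∑ a ∈ S, ∑ b ∈ S, (T k b * T i a) * ((if a = b then p else 1) • (T' a j * T' b l)
          + (if b < a then p - p⁻¹ else 0) • (T' b j * T' a l)) := by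
          rw [Finset.sum_comm (f := fun a b => (T k a * T i b) *
            ((if a < b then p - p⁻¹ else 0) • (T' a j * T' b l)))]
          simp only [← Finset.sum_add_distrib, mul_add]
    _ = _ := by
          simp only [hT' _ _ j l, mul_add, mul_smul_comm, Finset.sum_add_distrib,
            ← Finset.smul_sum]
          rw [key' i k j l, key' i k l j]

/-- A bidiagonal matrix whose entries satisfy the obvious `p`-commutation relations. -/
theorem bidiagonal {p : K} (hp : p ≠ 0) {D E : ℕ → A}
    (hDD : ∀ i k, D i * D k = D k * D i) (hEE : ∀ i k, E i * E k = E k * E i)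
    (hDE : ∀ i, D i * E i = p • (E i * D i))
    (hED : ∀ i, E i * D (i + 1) = p • (D (i + 1) * E i))
    (hcomm : ∀ i k, i ≠ k → i ≠ k + 1 → D i * E k = E k * D i) :
    IsQuantumMatrix p
      (fun i j => if j = i then D i else if j = i + 1 then E i else 0) := by
  intro i k j l
  by_cases h1 : j = i
  · subst h1
    by_cases h2 : l = k
    · subst h2
      rcases lt_trichotomy j l with h | h | h
      · simp [h, h.ne, h.ne', h.not_gt, hDD j l]
        grind
      · simp [h]
      · simp [h, h.ne, h.ne', h.not_gt, hDD j l]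
        grind
    · by_cases h3 : l = k + 1
      · subst h3
        rcases eq_or_ne j k with rfl | h4
        · simp [hDE, smul_smul, sub_smul, sub_mul, hp]
        · rcases eq_or_ne j (k + 1) with rfl | h5
          · simp [hED, smul_smul, sub_smul, sub_mul, hp]
          · simp [h4, h5, hcomm j k h4 h5]
      · simp [h2, h3]
        grind
  · by_cases h1' : j = i + 1
    · subst h1'
      by_cases h2 : l = k
      · subst h2
        rcases eq_or_ne l i with rfl | h4
        · simp [hDE, smul_smul]
        · rcases eq_or_ne l (i + 1) with rfl | h5
          · simp [hED]
          · simp [h4, h4.symm, h5, h5.symm, hcomm l i h4 h5]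
      · by_cases h3 : l = k + 1
        · subst h3
          rcases eq_or_ne i k with rfl | h4
          · simp
          · simp [h4, h4.symm, hEE i k]
            grind
        · simp [h2, h3]
          grind
    · simp [h1, h1']
      grind

theorem one {p : K} :
    IsQuantumMatrix p (fun i j : ℕ => if j = i then (1 : A) else 0) := by
  intro i k j l
  by_cases h1 : j = i <;> by_cases h2 : l = k <;> simp [h1, h2] <;> grind

end IsQuantumMatrix

end QuantumMatrix

section Jimbo

variable {K A : Type*} [Field K] [Ring A] [Algebra K A]

namespace IsQuantumMatrix

variable {p : K} {T : ℕ → ℕ → A}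

theorem row (h : IsQuantumMatrix p T) (hp : p ≠ 0) (i : ℕ) {j l : ℕ} (hjl : j < l) :
    T i l * T i j = p⁻¹ • (T i j * T i l) := by
  have := h i i l j
  simp only [↓reduceIte, lt_irrefl, hjl.ne', hjl.not_gt, zero_smul, add_zero, one_smul] at this
  rw [← this, smul_smul, inv_mul_cancel₀ hp, one_smul]

theorem column (h : IsQuantumMatrix p T) (hp : p ≠ 0) (j : ℕ) {i k : ℕ} (hik : i < k) :
    T k j * T i j = p⁻¹ • (T i j * T k j) := by
  have := h i k j j
  simp only [↓reduceIte, lt_irrefl, hik.ne, hik.not_gt, zero_smul, add_zero, one_smul] at this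
  rw [this, smul_smul, inv_mul_cancel₀ hp, one_smul]

theorem comm_of_gt (h : IsQuantumMatrix p T) {i j k l : ℕ} (hik : i < k) (hlj : l < j) :
    T k l * T i j = T i j * T k l := by
  have := h i k j l
  simpa [hik.ne, hik.not_gt, hlj.ne', hlj.not_gt] using this.symm

theorem comm_of_lt (h : IsQuantumMatrix p T) {i j k l : ℕ} (hik : i < k) (hjl : j < l) :
    T k l * T i j = T i j * T k l - (p - p⁻¹) • (T k j * T i l) := by
  have := h i k j l
  simp only [hik.ne, hik.not_gt, hjl.ne, hjl, ↓reduceIte, one_smul, zero_smul, add_zero] at this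
  rw [this, add_sub_cancel_right]

end IsQuantumMatrix

theorem mul_eq_smul_of_inverse {D D' X : A} (hl : D' * D = 1) (hr : D * D' = 1) {s : K}
    (h : D * X = s • (X * D)) : X * D' = s • (D' * X) := by
  calc X * D' = D' * (D * X) * D' := by rw [← mul_assoc D', hl, one_mul]
    _ = s • (D' * X * (D * D')) := by rw [h]; simp only [mul_smul_comm, smul_mul_assoc, mul_assoc]
    _ = _ := by rw [hr, mul_one]

theorem mul_mul_mul_eq_smul {D₁ D₂ X Y : A} {s : K} (h : X * D₂ = s • (D₂ * X)) :
    (D₁ * X) * (D₂ * Y) = s • (D₁ * D₂ * (X * Y)) := by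
  calc (D₁ * X) * (D₂ * Y) = D₁ * (X * D₂) * Y := by simp only [mul_assoc]
    _ = _ := by rw [h]; simp only [mul_smul_comm, smul_mul_assoc, mul_assoc]

end Jimbo

/-- An upper triangular quantum matrix with invertible diagonal entries yields a representation of
`U_q^+(A_N)`. -/
theorem IsQuantumMatrix.exists_algHom {K : Type} {A : Type*} [Field K] [Ring A] [Algebra K A]
    {q : K} (hq0 : q ≠ 0) (hq8 : q ^ 8 ≠ 1) {T : ℕ → ℕ → A} (hT : IsQuantumMatrix (q ^ 2) T)
    (hupper : ∀ i j, j < i → T i j = 0) {N : ℕ} {D : ℕ → A}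
    (hl : ∀ i ≤ N + 1, D i * T i i = 1) (hr : ∀ i ≤ N + 1, T i i * D i = 1) :
    ∃ (c : K) (φ : UqPlus K q N →ₐ[K] A), c ≠ 0 ∧
      ∀ a, φ (xg K q N a) = c • (D a.1.1 * T a.1.1 a.1.2) := by
  set p := q ^ 2 with hpdef
  have hp : p ≠ 0 := pow_ne_zero 2 hq0
  have hpp : p - p⁻¹ ≠ 0 := by
    intro h
    apply hq8
    have h1 : p * p = 1 := by
      rw [sub_eq_zero] at h
      nth_rewrite 2 [h]
      exact mul_inv_cancel₀ hp
    calc q ^ 8 = (p * p) * (p * p) := by rw [hpdef]; ring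
      _ = 1 := by rw [h1, one_mul]
  have hc : q / (p - p⁻¹) ≠ 0 := div_ne_zero hq0 hpp
  have hcc : q / (p - p⁻¹) * (p - p⁻¹) = q := div_mul_cancel₀ _ hpp
  set c := q / (p - p⁻¹)
  have hTT : ∀ {i m}, i < m → T m m * T i i = T i i * T m m := by
    intro i m him
    rw [hT.comm_of_lt him him, hupper m i him, zero_mul, smul_zero, sub_zero]
  have hDD : ∀ {i m}, i < m → m ≤ N + 1 → D m * D i = D i * D m := by
    intro i m him hm
    have h1 : T m m * D i = D i * T m m := by
      simpa using mul_eq_smul_of_inverse (s := (1 : K)) (hl i (by omega))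
        (hr i (by omega)) (X := T m m)
        (by rw [one_smul, hTT him])
    simpa using (mul_eq_smul_of_inverse (s := (1 : K)) (hl m hm) (hr m hm) (X := D i)
        (by rw [one_smul, h1])).symm
  -- moving the inverse diagonal entries to the left
  have hrow : ∀ {i j}, i < j → i ≤ N + 1 → T i j * D i = p • (D i * T i j) := by
    intro i j hij hi
    refine mul_eq_smul_of_inverse (hl i hi) (hr i hi) ?_
    rw [hT.row hp i hij, smul_smul, mul_inv_cancel₀ hp, one_smul]
  have hcol : ∀ {i j}, i < j → j ≤ N + 1 → T i j * D j = p⁻¹ • (D j * T i j) :=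
    fun {i j} hij hj => mul_eq_smul_of_inverse (hl j hj) (hr j hj) (hT.column hp j hij)
  have hin : ∀ {i j m}, i < m → m < j → m ≤ N + 1 →
      T i j * D m = (1 : K) • (D m * T i j) := by
    intro i j m him hmj hm
    refine mul_eq_smul_of_inverse (hl m hm) (hr m hm) ?_
    rw [one_smul, hT.comm_of_gt him hmj]
  have hright : ∀ {i j m}, i < m → j < m → m ≤ N + 1 →
      T i j * D m = (1 : K) • (D m * T i j) := by
    intro i j m him hjm hm
    refine mul_eq_smul_of_inverse (hl m hm) (hr m hm) ?_
    rw [one_smul, hT.comm_of_lt him hjm, hupper m j hjm, zero_mul, smul_zero, sub_zero]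
  have hleft : ∀ {i m n}, i < m → m < n → i ≤ N + 1 →
      T m n * D i = (1 : K) • (D i * T m n) := by
    intro i m n him hmn hi
    refine mul_eq_smul_of_inverse (hl i hi) (hr i hi) ?_
    rw [one_smul, hT.comm_of_lt him (him.trans hmn), hupper m i him, zero_mul, smul_zero,
      sub_zero]
  set u : ℕ → ℕ → A := fun i j => D i * T i j with hu
  refine ⟨c, RingQuot.liftAlgHom K ⟨FreeAlgebra.lift K fun a => c • u a.1.1 a.1.2, ?_⟩, hc, ?_⟩
  · intro x y hxy
    cases hxy with
    | c1 a b h1 h2 =>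
      have ha := a.2.2.1
      have haN : a.1.1 ≤ N + 1 := ha.le.trans a.2.2.2
      simp only [map_mul, map_smul, FreeAlgebra.lift_ι_apply, smul_mul_smul_comm]
      rw [smul_comm]
      congr 1
      rw [← h1]
      simp only [hu]
      rw [mul_mul_mul_eq_smul (hrow (ha.trans h2) haN), mul_mul_mul_eq_smul (hrow ha haN),
        hT.row hp _ h2, mul_smul_comm, smul_comm]
    | c3 a b h1 h2 =>
      have hb := b.2.2.1
      have hbN : b.1.1 ≤ N + 1 := hb.le.trans b.2.2.2
      simp only [map_mul, map_smul, FreeAlgebra.lift_ι_apply, smul_mul_smul_comm]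
      rw [smul_comm]
      congr 1
      rw [h2]
      simp only [hu]
      rw [mul_mul_mul_eq_smul (hleft h1 hb (h1.le.trans hbN)), mul_mul_mul_eq_smul (hin h1 hb hbN),
        hT.column hp _ h1, mul_smul_comm, hDD h1 hbN, one_smul, one_smul]
    | c2 a b h1 h2 =>
      have hb := b.2.2.1
      have hbN : b.1.1 ≤ N + 1 := hb.le.trans b.2.2.2
      simp only [map_mul, FreeAlgebra.lift_ι_apply, smul_mul_smul_comm]
      congr 1
      simp only [hu]
      rw [mul_mul_mul_eq_smul (hleft h1 hb (h1.le.trans hbN)),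
        mul_mul_mul_eq_smul (hin h1 (hb.trans h2) hbN),
        hT.comm_of_gt h1 h2, hDD h1 hbN]
    | c6 a b h1 =>
      have ha := a.2.2.1
      have haN : a.1.1 ≤ N + 1 := ha.le.trans a.2.2.2
      have hb := b.2.2.1
      have hbN : b.1.1 ≤ N + 1 := hb.le.trans b.2.2.2
      simp only [map_mul, FreeAlgebra.lift_ι_apply, smul_mul_smul_comm]
      congr 1
      simp only [hu]
      rw [mul_mul_mul_eq_smul (hleft (ha.trans h1) hb haN),
        mul_mul_mul_eq_smul (hright (ha.trans h1) h1 hbN),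
        hT.comm_of_lt (ha.trans h1) (h1.trans hb), hupper _ _ h1, hDD (ha.trans h1) hbN, zero_mul,
        smul_zero, sub_zero]
    | c4 a b c' d h1 h2 h3 h4 h5 =>
      have hb := b.2.2.1
      have hbN : b.1.1 ≤ N + 1 := hb.le.trans b.2.2.2
      simp only [map_mul, map_smul, map_sub, FreeAlgebra.lift_ι_apply, smul_mul_smul_comm]
      rw [smul_comm, ← smul_sub]
      congr 1
      rw [h4, h5]
      simp only [hu]
      rw [mul_mul_mul_eq_smul (hleft h1 hb (h1.le.trans hbN)), mul_mul_mul_eq_smul (hin h1 h2 hbN),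
        mul_mul_mul_eq_smul (hin h1 hb hbN),
        hT.comm_of_lt h1 h3, hDD h1 hbN, hT.comm_of_gt h1 h3]
      simp only [one_smul, mul_sub, mul_smul_comm, ← hpdef]
    | c5 a b c' h1 h2 =>
      have ha := a.2.2.1
      have haN : a.1.1 ≤ N + 1 := ha.le.trans a.2.2.2
      have hb := b.2.2.1
      have hbN : b.1.1 ≤ N + 1 := hb.le.trans b.2.2.2
      simp only [map_mul, map_smul, map_sub, FreeAlgebra.lift_ι_apply, smul_mul_smul_comm]
      rw [h2]
      simp only [hu]
      rw [← h1] at hb ⊢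
      rw [mul_mul_mul_eq_smul (hleft ha hb haN), mul_mul_mul_eq_smul (hcol ha a.2.2.2),
        hT.comm_of_lt ha hb, hDD ha a.2.2.2]
      have h3 : D a.1.1 * D a.1.2 * (T a.1.2 a.1.2 * T a.1.1 b.1.2) = D a.1.1 * T a.1.1 b.1.2 := by
        rw [mul_assoc, ← mul_assoc (D a.1.2), hl _ a.2.2.2, one_mul]
      have h4 : p * (c * c * p⁻¹) = c * c := by field_simp
      have h5 : c * c * (p - p⁻¹) = q * c := by rw [mul_assoc, hcc, mul_comm]
      simp only [← hpdef, mul_sub, smul_sub, mul_smul_comm, one_smul, smul_smul, h3, h4]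
      rw [← mul_sub, one_mul, one_mul, h5]
  · intro a
    rw [xg, RingQuot.liftAlgHom_mkAlgHom_apply, FreeAlgebra.lift_ι_apply]

section Oscillator

/-- Multiplication of functions by `ψ`. -/
def diagOp {K G : Type*} [Field K] (ψ : G → K) : Module.End K (G → K) where
  toFun f h := ψ h * f h
  map_add' _ _ := by ext h; simp [mul_add]
  map_smul' _ _ := by ext h; simp [mul_left_comm]

/-- Translation of functions by `g`. -/
def shiftOp (K : Type*) {G : Type*} [Field K] [AddCommMonoid G] (g : G) :
    Module.End K (G → K) where
  toFun f h := f (h + g)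
  map_add' _ _ := rfl
  map_smul' _ _ := rfl

@[simp] theorem diagOp_apply {K G : Type*} [Field K] (ψ : G → K) (f : G → K) (h : G) :
    diagOp ψ f h = ψ h * f h := rfl

@[simp] theorem shiftOp_apply {K G : Type*} [Field K] [AddCommMonoid G] (g : G) (f : G → K)
    (h : G) : shiftOp K g f h = f (h + g) := rfl

theorem diagOp_mul {K G : Type*} [Field K] (ψ χ : G → K) :
    diagOp ψ * diagOp χ = diagOp (ψ * χ) := by
  ext f h; simp [mul_assoc]

theorem diagOp_one {K G : Type*} [Field K] : diagOp (1 : G → K) = 1 := by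
  ext f h; simp

/-- The operator `X` acts to leading order (with respect to the weight `w`) as the translation
by `g`, up to nonzero scalars. -/
def HasLead {K G : Type*} [Field K] [AddCommMonoid G] (w : G →+ ℕ) (X : Module.End K (G → K))
    (g : G) : Prop :=
  ∃ c : G → K, (∀ h, c h ≠ 0) ∧ ∀ (f : G → K) (h : G),
    (∀ h', w h + w g < w h' → f h' = 0) → X f h = c h * f (h + g)

namespace HasLead

variable {K G : Type*} [Field K] [AddCommMonoid G] {w : G →+ ℕ} {X Y : Module.End K (G → K)}
  {g g' : G}

theorem diagOp {ψ : G → K} (hψ : ∀ h, ψ h ≠ 0) : HasLead w (diagOp ψ) 0 :=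
  ⟨ψ, hψ, fun f h _ => by simp⟩

theorem shiftOp (g : G) : HasLead w (shiftOp K g) g :=
  ⟨1, fun _ => one_ne_zero, fun f h _ => by simp⟩

theorem one : HasLead w (1 : Module.End K (G → K)) 0 :=
  ⟨1, fun _ => one_ne_zero, fun f h _ => by simp⟩

theorem smul (hX : HasLead w X g) {c : K} (hc : c ≠ 0) : HasLead w (c • X) g := by
  obtain ⟨a, ha, h1⟩ := hX
  refine ⟨c • a, fun h => mul_ne_zero hc (ha h), fun f h hf => ?_⟩
  simp [h1 f h hf, mul_assoc]

theorem mul (hX : HasLead w X g) (hY : HasLead w Y g') : HasLead w (X * Y) (g + g') := by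
  obtain ⟨a, ha, h1⟩ := hX
  obtain ⟨b, hb, h2⟩ := hY
  refine ⟨fun h => a h * b (h + g), fun h => mul_ne_zero (ha h) (hb _), fun f h hf => ?_⟩
  rw [map_add] at hf
  rw [Module.End.mul_apply, h1, h2, add_assoc, mul_assoc]
  · intro h' hh'
    rw [map_add] at hh'
    exact hf h' (by omega)
  · intro h' hh'
    rw [h2, hf, mul_zero]
    · rw [map_add]; omega
    · intro h'' hh''
      exact hf h'' (by omega)

theorem add (hX : HasLead w X g) (hY : HasLead w Y g') (hlt : w g < w g') :
    HasLead w (X + Y) g := by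
  obtain ⟨a, ha, h1⟩ := hX
  obtain ⟨b, hb, h2⟩ := hY
  refine ⟨a, ha, fun f h hf => ?_⟩
  rw [LinearMap.add_apply, Pi.add_apply, h1 f h hf, h2, hf (h + g'), mul_zero, add_zero]
  · rw [map_add]; omega
  · intro h' hh'
    exact hf h' (by omega)

theorem pow (hX : HasLead w X g) (n : ℕ) : HasLead w (X ^ n) (n • g) := by
  induction n with
  | zero => simpa using one
  | succ n ih => rw [pow_succ, succ_nsmul]; exact ih.mul hX

theorem list_prod {α : Type*} {F : α → Module.End K (G → K)} {v : α → G} (l : List α)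
    (h : ∀ a, HasLead w (F a) (v a)) : HasLead w (l.map F).prod (l.map v).sum := by
  induction l with
  | nil => simpa using one
  | cons a l ih => simpa using (h a).mul ih

/-- Operators with distinct leading translations are linearly independent. -/
theorem linearIndependent {ι : Type*} {X : ι → Module.End K (G → K)} {v : ι → G}
    (hX : ∀ i, HasLead w (X i) (v i)) (hv : Function.Injective v) :
    LinearIndependent K X := by
  classical
  rw [linearIndependent_iff']
  intro s a hsum
  by_contra! hne
  obtain ⟨i, hi, hai⟩ := hne
  obtain ⟨m, hm, hmin⟩ := (s.filter fun i => a i ≠ 0).exists_min_image (fun i => w (v i))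
    ⟨i, Finset.mem_filter.2 ⟨hi, hai⟩⟩
  rw [Finset.mem_filter] at hm
  choose c hc hlead using hX
  have h0 : (∑ i ∈ s, a i • X i) (Pi.single (v m) 1) 0 = 0 := by rw [hsum]; rfl
  rw [LinearMap.sum_apply, Finset.sum_apply, Finset.sum_eq_single_of_mem m hm.1] at h0
  · rw [LinearMap.smul_apply, Pi.smul_apply, hlead m] at h0
    · simp only [zero_add, Pi.single_eq_same, smul_eq_mul, mul_one] at h0
      exact mul_ne_zero hm.2 (hc m 0) h0
    · intro h' hh'
      rw [Pi.single_eq_of_ne]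
      rintro rfl
      simp at hh'
  · intro j hj hjm
    rw [LinearMap.smul_apply, Pi.smul_apply]
    by_cases haj : a j = 0
    · rw [haj, zero_smul]
    · rw [hlead j, zero_add, Pi.single_eq_of_ne (hv.ne hjm), mul_zero, smul_zero]
      intro h' hh'
      rw [Pi.single_eq_of_ne]
      rintro rfl
      have := hmin j (Finset.mem_filter.2 ⟨hj, haj⟩)
      simp at hh'
      omega

end HasLead

end Oscillator

section TriangularRepresentation

variable {K : Type*} [Field K]

/-- The diagonal entries of the elementary bidiagonal quantum matrices. -/
def diagEntry (p : K) (r i : ℕ) : Module.End K ((ℕ × ℕ →₀ ℕ) → K) :=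
  diagOp fun h => p ^ ((h (i, r) : ℤ) - h (i + 1, r))

/-- The superdiagonal entries of the elementary bidiagonal quantum matrices. -/
noncomputable def superEntry (K : Type*) [Field K] (r i : ℕ) : Module.End K ((ℕ × ℕ →₀ ℕ) → K) :=
  shiftOp K (Finsupp.single (i + 1, r) 1)

/-- The `r`-th elementary bidiagonal quantum matrix. -/
noncomputable def bidiag (p : K) (r i j : ℕ) : Module.End K ((ℕ × ℕ →₀ ℕ) → K) :=
  if j = i then diagEntry p r i else if j = i + 1 then superEntry K r i else 0

theorem diagEntry_comm (p : K) (r s i j : ℕ) :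
    diagEntry p r i * diagEntry p s j = diagEntry p s j * diagEntry p r i := by
  rw [diagEntry, diagEntry, diagOp_mul, diagOp_mul, mul_comm]

theorem superEntry_comm (r s i j : ℕ) :
    superEntry K r i * superEntry K s j = superEntry K s j * superEntry K r i := by
  ext f h
  simp only [superEntry, Module.End.mul_apply, shiftOp_apply]
  rw [add_right_comm]

theorem diagEntry_superEntry_comm (p : K) {r s i j : ℕ}
    (h : r ≠ s ∨ i ≠ j ∧ i ≠ j + 1) :
    diagEntry p r i * superEntry K s j = superEntry K s j * diagEntry p r i := by
  ext f x
  have h1 : (Finsupp.single (j + 1, s) 1 : ℕ × ℕ →₀ ℕ) (i, r) = 0 :=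
    Finsupp.single_eq_of_ne (by simp only [ne_eq, Prod.mk.injEq]; omega)
  have h2 : (Finsupp.single (j + 1, s) 1 : ℕ × ℕ →₀ ℕ) (i + 1, r) = 0 :=
    Finsupp.single_eq_of_ne (by simp only [ne_eq, Prod.mk.injEq]; omega)
  simp [superEntry, diagEntry, h1, h2]

theorem diagEntry_mul_superEntry {p : K} (hp : p ≠ 0) (r i : ℕ) :
    diagEntry p r i * superEntry K r i = p • (superEntry K r i * diagEntry p r i) := by
  ext f x
  have h1 : (Finsupp.single (i + 1, r) 1 : ℕ × ℕ →₀ ℕ) (i, r) = 0 :=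
    Finsupp.single_eq_of_ne (by simp)
  simp only [superEntry, diagEntry, Module.End.mul_apply, shiftOp_apply, diagOp_apply,
    LinearMap.smul_apply, Pi.smul_apply, Finsupp.add_apply, h1, Finsupp.single_eq_same,
    smul_eq_mul]
  rw [← mul_assoc, ← zpow_one_add₀ hp]
  congr 2
  push_cast
  ring

theorem superEntry_mul_diagEntry {p : K} (hp : p ≠ 0) (r i : ℕ) :
    superEntry K r i * diagEntry p r (i + 1)
      = p • (diagEntry p r (i + 1) * superEntry K r i) := by
  ext f x
  have h1 : (Finsupp.single (i + 1, r) 1 : ℕ × ℕ →₀ ℕ) (i + 1 + 1, r) = 0 :=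
    Finsupp.single_eq_of_ne (by simp)
  simp only [superEntry, diagEntry, Module.End.mul_apply, shiftOp_apply, diagOp_apply,
    LinearMap.smul_apply, Pi.smul_apply, Finsupp.add_apply, h1, Finsupp.single_eq_same,
    smul_eq_mul]
  rw [← mul_assoc, ← zpow_one_add₀ hp]
  congr 2
  push_cast
  ring

theorem isQuantumMatrix_bidiag {p : K} (hp : p ≠ 0) (r : ℕ) :
    IsQuantumMatrix p (bidiag p r) :=
  IsQuantumMatrix.bidiagonal hp (diagEntry_comm p r r) (superEntry_comm r r)
    (diagEntry_mul_superEntry hp r) (superEntry_mul_diagEntry hp r)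
    fun _ _ h h' => diagEntry_superEntry_comm p (Or.inr ⟨h, h'⟩)

theorem bidiag_commute (p : K) {r s : ℕ} (h : r ≠ s) (i j k l : ℕ) :
    Commute (bidiag p r i j) (bidiag p s k l) := by
  unfold bidiag
  split_ifs
  · exact diagEntry_comm p r s i k
  · exact diagEntry_superEntry_comm p (Or.inl h)
  · exact Commute.zero_right _
  · exact (diagEntry_superEntry_comm p (Or.inl h.symm)).symm
  · exact superEntry_comm r s i k
  all_goals simp

/-- The product of the first `r` elementary bidiagonal quantum matrices with indices in
`range n`. -/
noncomputable def triangular (p : K) (n : ℕ) : ℕ → ℕ → ℕ → Module.End K ((ℕ × ℕ →₀ ℕ) → K)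
  | 0, i, j => if j = i then 1 else 0
  | r + 1, i, j => ∑ a ∈ Finset.range n, triangular p n r i a * bidiag p r a j

theorem triangular_commute (p : K) (n : ℕ) {r s : ℕ} (h : r ≤ s) (i j k l : ℕ) :
    Commute (triangular p n r i j) (bidiag p s k l) := by
  induction r generalizing i j with
  | zero => unfold triangular; split_ifs <;> simp
  | succ r ih =>
    exact Commute.sum_left _ _ _ fun a _ =>
      (ih (by omega) i a).mul_left (bidiag_commute p (by omega) a j k l)

theorem isQuantumMatrix_triangular {p : K} (hp : p ≠ 0) (n r : ℕ) :
    IsQuantumMatrix p (triangular p n r) := by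
  induction r with
  | zero => exact IsQuantumMatrix.one
  | succ r ih =>
    exact ih.mul (isQuantumMatrix_bidiag hp r) (triangular_commute p n le_rfl) (Finset.range n)

theorem triangular_eq_zero (p : K) (n r : ℕ) {i j : ℕ} (h : j < i ∨ i + r < j) :
    triangular p n r i j = 0 := by
  induction r generalizing j with
  | zero => simp only [triangular]; rw [if_neg (by omega)]
  | succ r ih =>
    refine Finset.sum_eq_zero fun a _ => ?_
    by_cases ha : a < i ∨ i + r < a
    · rw [ih ha, zero_mul]
    · rw [bidiag, if_neg (by omega), if_neg (by omega), mul_zero]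

theorem triangular_succ_zero (p : K) {n : ℕ} (r i : ℕ) (hn : 0 < n) :
    triangular p n (r + 1) i 0 = triangular p n r i 0 * diagEntry p r 0 := by
  rw [triangular, Finset.sum_eq_single_of_mem 0 (Finset.mem_range.2 hn)]
  · simp [bidiag]
  · intro a _ ha
    rw [bidiag, if_neg (Ne.symm ha), if_neg (by omega), mul_zero]

theorem triangular_succ_succ (p : K) {n : ℕ} (r i : ℕ) {j : ℕ} (hj : j + 1 < n) :
    triangular p n (r + 1) i (j + 1) = triangular p n r i (j + 1) * diagEntry p r (j + 1)
      + triangular p n r i j * superEntry K r j := by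
  rw [triangular, Finset.sum_eq_add_of_mem (j + 1) j (Finset.mem_range.2 hj)
    (Finset.mem_range.2 (by omega)) (by omega)]
  · simp [bidiag]
  · intro a _ ha
    rw [bidiag, if_neg (by omega), if_neg (by omega), mul_zero]

theorem triangular_succ_self (p : K) {n : ℕ} (r : ℕ) {i : ℕ} (hi : i < n) :
    triangular p n (r + 1) i i = triangular p n r i i * diagEntry p r i := by
  cases i with
  | zero => exact triangular_succ_zero p r 0 hi
  | succ i =>
    rw [triangular_succ_succ p r _ hi, triangular_eq_zero p n r (j := i) (Or.inl (by omega)),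
      zero_mul, add_zero]

theorem exists_triangular_self {p : K} (hp : p ≠ 0) {n : ℕ} (r : ℕ) {i : ℕ} (hi : i < n) :
    ∃ ψ : (ℕ × ℕ →₀ ℕ) → K, (∀ h, ψ h ≠ 0) ∧ triangular p n r i i = diagOp ψ := by
  induction r with
  | zero => exact ⟨1, fun _ => one_ne_zero, by simp [triangular, diagOp_one]⟩
  | succ r ih =>
    obtain ⟨ψ, hψ, h⟩ := ih
    refine ⟨_, fun x => ?_, by rw [triangular_succ_self p r hi, h, diagEntry, diagOp_mul]⟩
    exact mul_ne_zero (hψ x) (zpow_ne_zero _ hp)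

/-- The exponent of the leading term of the entry `(i, i + m)` of `triangular`. -/
noncomputable def leadExp (i m : ℕ) : ℕ × ℕ →₀ ℕ :=
  ∑ s ∈ Finset.range m, Finsupp.single (i + s + 1, s) 1

/-- The weight giving a variable of the `r`-th bidiagonal factor weight `r`. -/
noncomputable def levelWeight : (ℕ × ℕ →₀ ℕ) →+ ℕ :=
  Finsupp.liftAddHom fun x => AddMonoidHom.mulLeft x.2

theorem hasLead_diagEntry {p : K} (hp : p ≠ 0) (r i : ℕ) :
    HasLead levelWeight (diagEntry p r i) 0 :=
  HasLead.diagOp fun _ => zpow_ne_zero _ hp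

theorem hasLead_triangular {p : K} (hp : p ≠ 0) {n : ℕ} (r i m : ℕ) (hm : m ≤ r)
    (hn : i + m < n) : HasLead levelWeight (triangular p n r i (i + m)) (leadExp i m) := by
  induction r generalizing m with
  | zero =>
    obtain rfl : m = 0 := by omega
    simpa [triangular, leadExp] using HasLead.one
  | succ r ih =>
    cases m with
    | zero =>
      rw [add_zero, triangular_succ_self p r (by omega)]
      simpa using (ih 0 (by omega) (by omega)).mul (hasLead_diagEntry hp r i)
    | succ m =>
      have h2 := (ih m (by omega) (by omega)).mul
        (HasLead.shiftOp (w := levelWeight) (K := K) (Finsupp.single (i + m + 1, r) 1))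
      rw [← add_assoc, triangular_succ_succ p r i (by omega)]
      rcases Nat.lt_or_ge m r with hlt | hge
      · have h1 := (ih (m + 1) (by omega) (by omega)).mul (hasLead_diagEntry hp r (i + m + 1))
        rw [add_zero] at h1
        refine h1.add h2 ?_
        rw [leadExp, Finset.sum_range_succ, map_add, map_add]
        refine Nat.add_lt_add_left ?_ _
        simpa [levelWeight] using hlt
      · obtain rfl : m = r := by omega
        rw [triangular_eq_zero p n m (Or.inr (by omega)), zero_mul, zero_add, leadExp,
          Finset.sum_range_succ]
        exact h2

end TriangularRepresentation

section LinearIndependence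

theorem leadExp_apply (i m k s : ℕ) :
    leadExp i m (k + s + 1, s) = if i = k ∧ s < m then 1 else 0 := by
  rw [leadExp, Finsupp.finsetSum_apply]
  split_ifs with h
  · obtain ⟨rfl, h⟩ := h
    rw [Finset.sum_eq_single_of_mem s (Finset.mem_range.2 h), Finsupp.single_eq_same]
    intro t _ hts
    exact Finsupp.single_eq_of_ne (by simp only [ne_eq, Prod.mk.injEq]; omega)
  · refine Finset.sum_eq_zero fun t ht => ?_
    rw [Finset.mem_range] at ht
    exact Finsupp.single_eq_of_ne (by simp only [ne_eq, Prod.mk.injEq]; omega)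

theorem sum_leadExp_apply {N : ℕ} (α : Lam N →₀ ℕ) (k s : ℕ) :
    (α.sum fun p n => n • leadExp p.1.1 (p.1.2 - p.1.1)) (k + s + 1, s)
      = α.sum fun p n => if p.1.1 = k ∧ s < p.1.2 - p.1.1 then n else 0 := by
  rw [Finsupp.sum, Finsupp.sum, Finsupp.finsetSum_apply]
  refine Finset.sum_congr rfl fun p _ => ?_
  rw [Finsupp.smul_apply, leadExp_apply]
  simp

/-- The leading exponents of the generators are linearly independent over `ℕ`. -/
theorem sum_leadExp_injective (N : ℕ) : Function.Injective fun α : Lam N →₀ ℕ =>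
    α.sum fun p n => n • leadExp p.1.1 (p.1.2 - p.1.1) := by
  have key : ∀ (α : Lam N →₀ ℕ) (p : Lam N),
      (α.sum fun p n => n • leadExp p.1.1 (p.1.2 - p.1.1))
          (p.1.1 + (p.1.2 - p.1.1 - 1) + 1, p.1.2 - p.1.1 - 1)
        = (α.sum fun p n => n • leadExp p.1.1 (p.1.2 - p.1.1))
          (p.1.1 + (p.1.2 - p.1.1) + 1, p.1.2 - p.1.1) + α p := by
    intro α p
    have h : α p = α.sum fun x n => if x = p then n else 0 := by
      rw [Finsupp.sum_ite_self_eq']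
    rw [sum_leadExp_apply, sum_leadExp_apply, h, ← Finsupp.sum_add]
    refine Finsupp.sum_congr fun x _ => ?_
    have hx : x = p ↔ x.1.1 = p.1.1 ∧ x.1.2 = p.1.2 := by
      rw [← Prod.ext_iff]; exact Subtype.ext_iff
    have hx1 := x.2.2.1
    have hp1 := p.2.2.1
    simp only [hx]
    split_ifs <;> omega
  intro α β hαβ
  ext p
  have h1 := key α p
  have h2 := key β p
  simp only at hαβ
  rw [hαβ] at h1
  omega

theorem linearIndependent_mon {K : Type} [Field K] {q : K} (hq0 : q ≠ 0) (hq8 : q ^ 8 ≠ 1)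
    (N : ℕ) : LinearIndependent K (mon K q N) := by
  have hp : q ^ 2 ≠ 0 := pow_ne_zero 2 hq0
  have hdiag : ∀ i, ∃ ψ : (ℕ × ℕ →₀ ℕ) → K, (∀ h, ψ h ≠ 0) ∧
      (i ≤ N + 1 → triangular (q ^ 2) (N + 2) N i i = diagOp ψ) := by
    intro i
    by_cases hi : i ≤ N + 1
    · obtain ⟨ψ, h1, h2⟩ := exists_triangular_self hp N (Nat.lt_succ_of_le hi)
      exact ⟨ψ, h1, fun _ => h2⟩
    · exact ⟨1, fun _ => one_ne_zero, fun h => absurd h hi⟩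
  choose ψ hψ hT using hdiag
  obtain ⟨c, φ, hc, hφ⟩ := (isQuantumMatrix_triangular hp (N + 2) N).exists_algHom hq0 hq8
    (fun i j h => triangular_eq_zero _ _ _ (Or.inl h)) (N := N) (D := fun i => diagOp (ψ i)⁻¹)
    (fun i hi => by
      rw [hT i hi, diagOp_mul, ← diagOp_one]
      congr 1
      ext h
      exact inv_mul_cancel₀ (hψ i h))
    (fun i hi => by
      rw [hT i hi, diagOp_mul, ← diagOp_one]
      congr 1
      ext h
      exact mul_inv_cancel₀ (hψ i h))
  have hgen : ∀ a, HasLead levelWeight (φ (xg K q N a)) (leadExp a.1.1 (a.1.2 - a.1.1)) := by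
    intro a
    have ha := a.2
    have h1 := hasLead_triangular hp (n := N + 2) N a.1.1 (a.1.2 - a.1.1) (by omega) (by omega)
    rw [Nat.add_sub_cancel' ha.2.1.le] at h1
    rw [hφ, ← zero_add (leadExp _ _)]
    exact ((HasLead.diagOp fun h => inv_ne_zero (hψ a.1.1 h)).mul h1).smul hc
  have hmon : ∀ α, HasLead levelWeight (φ (mon K q N α))
      (α.sum fun p n => n • leadExp p.1.1 (p.1.2 - p.1.1)) := by
    intro α
    have h := HasLead.list_prod (α.support.sort (· ≤ ·)) fun a => (hgen a).pow (α a)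
    rw [← Multiset.sum_coe, ← Multiset.map_coe, Finset.sort_eq] at h
    rw [mon, map_list_prod, List.map_map]
    simpa only [Function.comp_def, map_pow, Finsupp.sum, Finset.sum] using h
  exact LinearIndependent.of_comp φ.toLinearMap
    (HasLead.linearIndependent hmon (sum_leadExp_injective N))

end LinearIndependence

section Span

variable (K : Type) [Field K] (q : K) (N : ℕ)

/-- The image of a word in the generators. -/
noncomputable def wordProd (l : List (Lam N)) : UqPlus K q N := (l.map (xg K q N)).prod

theorem wordProd_append (l l' : List (Lam N)) :
    wordProd K q N (l ++ l') = wordProd K q N l * wordProd K q N l' := by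
  simp [wordProd]

theorem lam_lt_iff {N : ℕ} {a b : Lam N} :
    a < b ↔ a.1.1 < b.1.1 ∨ a.1.1 = b.1.1 ∧ a.1.2 < b.1.2 :=
  Prod.Lex.toLex_lt_toLex

instance (N : ℕ) : Finite (Lam N) :=
  Finite.of_injective
    (fun p => (⟨⟨p.1.1, by have := p.2; omega⟩, ⟨p.1.2, by have := p.2; omega⟩⟩ :
      Fin (N + 2) × Fin (N + 2)))
    fun a b h => by
      simp only [Prod.mk.injEq, Fin.mk.injEq] at h
      exact Subtype.ext (Prod.ext h.1 h.2)

/-- A sorted word is an ordered monomial. -/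
theorem wordProd_eq_mon {l : List (Lam N)} (hl : l.Pairwise (· ≤ ·)) :
    wordProd K q N l = mon K q N (Multiset.toFinsupp (l : Multiset (Lam N))) := by
  set α := Multiset.toFinsupp (l : Multiset (Lam N)) with hα
  have key : l = (α.support.sort (· ≤ ·)).flatMap fun p => List.replicate (α p) p := by
    refine List.Perm.eq_of_pairwise (le := (· ≤ ·)) (fun a b _ _ => le_antisymm) hl ?_ ?_
    · rw [List.pairwise_flatMap]
      refine ⟨fun p _ => List.pairwise_replicate.2 (Or.inr le_rfl), ?_⟩
      refine (Finset.pairwise_sort _ _).imp fun hab x hx y hy => ?_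
      rw [List.eq_of_mem_replicate hx, List.eq_of_mem_replicate hy]
      exact hab
    · rw [← Multiset.coe_eq_coe, ← Multiset.coe_bind, Finset.sort_eq,
        ← Multiset.toFinsupp_toMultiset (l : Multiset (Lam N)), ← hα, Finsupp.toMultiset_apply]
      simp only [Multiset.bind, Multiset.join, Finsupp.sum, Finset.sum, Multiset.coe_replicate,
        Multiset.nsmul_singleton]
  rw [mon, wordProd]
  conv_lhs => rw [key]
  rw [List.map_flatMap, List.flatMap, List.prod_flatten, List.map_map]
  simp [Function.comp_def]

theorem xg_mul_xg_mem {a b : Lam N} (hab : a < b) :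
    xg K q N b * xg K q N a ∈ Submodule.span K
      (wordProd K q N '' {l | l.length < 2 ∨ ∃ c d, c < b ∧ l = [c, d]}) := by
  have hrel : ∀ {x}, JimboRel K q N (FreeAlgebra.ι K b * FreeAlgebra.ι K a) x →
      xg K q N b * xg K q N a = RingQuot.mkAlgHom K (JimboRel K q N) x := by
    intro x hx
    rw [← RingQuot.mkAlgHom_rel K hx, map_mul]
    rfl
  have h1 : ∀ c, xg K q N c ∈ Submodule.span K
      (wordProd K q N '' {l | l.length < 2 ∨ ∃ c d, c < b ∧ l = [c, d]}) := fun c =>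
    Submodule.subset_span ⟨[c], Or.inl (by simp), by simp [wordProd]⟩
  have h2 : ∀ {c} d, c < b → xg K q N c * xg K q N d ∈ Submodule.span K
      (wordProd K q N '' {l | l.length < 2 ∨ ∃ c d, c < b ∧ l = [c, d]}) := fun {c} d hc =>
    Submodule.subset_span ⟨[c, d], Or.inr ⟨c, d, hc, rfl⟩, by simp [wordProd]⟩
  have ha := a.2
  have hb := b.2
  rcases lam_lt_iff.1 hab with h | ⟨h, h'⟩
  · rcases lt_trichotomy a.1.2 b.1.2 with h' | h' | h'
    · rcases lt_trichotomy a.1.2 b.1.1 with h'' | h'' | h''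
      · rw [hrel (.c6 a b h''), map_mul]
        exact h2 b hab
      · rw [hrel (.c5 a b ⟨(a.1.1, b.1.2), by dsimp only; omega⟩ h'' rfl), map_sub, map_smul,
          map_smul, map_mul]
        exact sub_mem (Submodule.smul_mem _ _ (h2 b hab)) (Submodule.smul_mem _ _ (h1 _))
      · rw [hrel (.c4 a b ⟨(a.1.1, b.1.2), by dsimp only; omega⟩
          ⟨(b.1.1, a.1.2), by dsimp only; omega⟩ h h'' h' rfl rfl), map_sub, map_smul,
          map_mul, map_mul]
        exact sub_mem (h2 b hab) (Submodule.smul_mem _ _ (h2 _ (lam_lt_iff.2 (Or.inl h))))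
    · rw [hrel (.c3 a b h h'), map_smul, map_mul]
      exact Submodule.smul_mem _ _ (h2 b hab)
    · rw [hrel (.c2 a b h h'), map_mul]
      exact h2 b hab
  · rw [hrel (.c1 a b h h'), map_smul, map_mul]
    exact Submodule.smul_mem _ _ (h2 b hab)

/-- Every word reduces to a linear combination of ordered monomials. -/
theorem wordProd_mem_span (l : List (Lam N)) :
    wordProd K q N l ∈ Submodule.span K (Set.range (mon K q N)) := by
  induction l using (List.Shortlex.wf (wellFounded_lt (α := Lam N))).induction with
  | _ l ih =>
  by_cases hl : l.Pairwise (· ≤ ·)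
  · rw [wordProd_eq_mon K q N hl]
    exact Submodule.subset_span ⟨_, rfl⟩
  · rw [← List.isChain_iff_pairwise, List.isChain_iff_forall_rel_of_append_cons_cons] at hl
    push Not at hl
    obtain ⟨b, a, u, v, rfl, hab⟩ := hl
    have key : ∀ z ∈ Submodule.span K
        (wordProd K q N '' {l | l.length < 2 ∨ ∃ c d, c < b ∧ l = [c, d]}),
        wordProd K q N u * z * wordProd K q N v
          ∈ Submodule.span K (Set.range (mon K q N)) := by
      intro z hz
      induction hz using Submodule.span_induction with
      | mem z hz =>
        obtain ⟨w, hw, rfl⟩ := hz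
        rw [← wordProd_append, ← wordProd_append]
        apply ih
        rcases hw with hw | ⟨c, d, hc, rfl⟩
        · refine List.Shortlex.of_length_lt ?_
          simp only [List.length_append, List.length_cons]
          omega
        · rw [List.append_assoc]
          refine List.Shortlex.append_left (List.Shortlex.of_lex (by simp) ?_) u
          exact List.Lex.rel hc
      | zero => simp
      | add x y _ _ hx hy => rw [mul_add, add_mul]; exact add_mem hx hy
      | smul c x _ hx =>
        rw [mul_smul_comm, smul_mul_assoc]; exact Submodule.smul_mem _ _ hx
    have := key _ (xg_mul_xg_mem K q N hab)
    simpa [wordProd, mul_assoc] using this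

theorem span_mon : Submodule.span K (Set.range (mon K q N)) = ⊤ := by
  have hmul : ∀ x ∈ Submodule.span K (Set.range (wordProd K q N)),
      ∀ y ∈ Submodule.span K (Set.range (wordProd K q N)),
      x * y ∈ Submodule.span K (Set.range (wordProd K q N)) := by
    intro x hx y hy
    have := Submodule.mul_mem_mul hx hy
    rw [Submodule.span_mul_span] at this
    refine Submodule.span_mono ?_ this
    rintro _ ⟨_, ⟨l, rfl⟩, _, ⟨l', rfl⟩, rfl⟩
    exact ⟨l ++ l', wordProd_append K q N l l'⟩
  have hword : Submodule.span K (Set.range (wordProd K q N)) = ⊤ := by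
    rw [eq_top_iff]
    rintro x -
    obtain ⟨x, rfl⟩ := RingQuot.mkAlgHom_surjective K (JimboRel K q N) x
    induction x using FreeAlgebra.induction with
    | grade0 c =>
      rw [AlgHom.commutes, Algebra.algebraMap_eq_smul_one]
      exact Submodule.smul_mem _ _ (Submodule.subset_span ⟨[], by simp [wordProd]⟩)
    | grade1 a => exact Submodule.subset_span ⟨[a], by simp [wordProd, xg]⟩
    | mul x y hx hy => rw [map_mul]; exact hmul _ hx _ hy
    | add x y hx hy => rw [map_add]; exact add_mem hx hy
  rw [eq_top_iff, ← hword, Submodule.span_le]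
  rintro _ ⟨l, rfl⟩
  exact wordProd_mem_span K q N l

end Span

/-- If q^8 ≠ 1, the ordered monomials m_α, indexed by finitely supported
α : Λ_N → ℕ, form a K-basis of U_q^+(A_N): they are linearly independent and span. -/
theorem uqPlus_pbwBasis (K : Type) [Field K] (q : K) (hq0 : q ≠ 0)
    (hq8 : q ^ 8 ≠ 1) (N : ℕ) (hN : 1 ≤ N) :
    LinearIndependent K (mon K q N) ∧
    Submodule.span K (Set.range (mon K q N)) = ⊤ := by
  exact ⟨linearIndependent_mon hq0 hq8 N, span_mon K q N⟩
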